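/- The critical diffusion nodes of any node are totally ordered by the critical-node relation: given a reported profile t' and a node i with a non-nil reported type, for any pair of nodes j, k ∈ C_i(t'), either j ∈ C_k(t') or k ∈ C_j(t'). Consequently there is a unique fully ordered sequence C*_i(t') = {s_1, s_2, …, s_k, s_{k+1}, …, i} of all nodes in C_i(t') such that each s_j is a critical diffusion node of s_{j+1}. -/

import Mathlib

/-- A diffusion setting on a digraph: a seller `s`, the seller's
out-neighbours `rs`, and each node's true set of out-neighbours `r`. -/
structure DiffusionSetting (V : Type*) where
  s : V
  rs : Finset V
  r : V → Finset V

/-- A reported type profile: each node either reports a bid together with a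
diffusion set, or has the `nil` type (`none`). -/
abbrev Profile (V : Type*) := V → Option (ℝ × Finset V)

variable {V : Type*}

/-- The reported diffusion set of node `i` (empty if `nil`). -/
def rset (t' : Profile V) (i : V) : Finset V := ((t' i).map Prod.snd).getD ∅

namespace DiffusionSetting

variable (S : DiffusionSetting V)

/-- `L = (a₁, …, a_{l+1} = i)` is a trading path from the seller `s` to `i`:
`a₁ ∈ r_s` and each `a_j` belongs to the reported diffusion set of `a_{j-1}`. -/
def IsTradingPath (t' : Profile V) (i : V) (L : List V) : Prop :=
  L ≠ [] ∧ L.getLast? = some i ∧ (∀ a ∈ L.head?, a ∈ S.rs) ∧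
    L.Chain' (fun a b => b ∈ rset t' a)

/-- `i` has a non-`nil` reported type, i.e. it is reachable by a trading path. -/
def Informed (t' : Profile V) (i : V) : Prop := ∃ L, S.IsTradingPath t' i L

/-- `C_i(t')`: the critical diffusion nodes of `i`, the intersection of all
trading paths from the seller to `i`. -/
def critSet (t' : Profile V) (i : V) : Set V :=
  {j | ∀ L, S.IsTradingPath t' i L → j ∈ L}

/-- `L` is the critical diffusion sequence `C*_i(t')`: a duplicate-free
enumeration of `C_i(t')` ending in `i` in which each node is a critical
diffusion node of its successor. -/
def IsCritSeq (t' : Profile V) (i : V) (L : List V) : Prop :=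
  L.Nodup ∧ (∀ j, j ∈ L ↔ j ∈ S.critSet t' i) ∧ L.getLast? = some i ∧
    L.Chain' (fun a b => a ∈ S.critSet t' b)

end DiffusionSetting

theorem List.exists_first_of_exists_mem {α : Type*} {p : α → Prop} {L : List α}
    (h : ∃ x ∈ L, p x) : ∃ A x B, L = A ++ x :: B ∧ p x ∧ ∀ a ∈ A, ¬ p a := by
  induction L with
  | nil => simp at h
  | cons y L ih =>
    by_cases hy : p y
    · exact ⟨[], y, L, rfl, hy, by simp⟩
    · obtain ⟨A, x, B, rfl, hx, hA⟩ := ih (by simpa [hy] using h)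
      exact ⟨y :: A, x, B, rfl, hx, by simpa [hy] using hA⟩

theorem List.exists_last_of_exists_mem {α : Type*} {p : α → Prop} {L : List α}
    (h : ∃ x ∈ L, p x) : ∃ A x B, L = A ++ x :: B ∧ p x ∧ ∀ b ∈ B, ¬ p b := by
  obtain ⟨A, x, B, hL, hx, hA⟩ :=
    List.exists_first_of_exists_mem (L := L.reverse) (p := p) (by simpa using h)
  refine ⟨B.reverse, x, A.reverse, ?_, hx, by simpa using hA⟩
  simpa using congrArg List.reverse hL

namespace DiffusionSetting

variable {S : DiffusionSetting V} {t' : Profile V} {i j k : V}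

theorem IsTradingPath.truncate {A B : List V} (h : S.IsTradingPath t' i (A ++ j :: B)) :
    S.IsTradingPath t' j (A ++ [j]) := by
  obtain ⟨-, -, hs, hc⟩ := h
  refine ⟨by simp, by simp, ?_, (List.isChain_split.mp hc).1⟩
  cases A <;> simpa using hs

theorem IsTradingPath.splice {A B P : List V} (h : S.IsTradingPath t' i (A ++ j :: B))
    (hP : S.IsTradingPath t' j P) : S.IsTradingPath t' i (P ++ B) := by
  obtain ⟨-, hl, -, hc⟩ := h
  obtain ⟨hne, hPl, hPs, hPc⟩ := hP
  obtain ⟨Q, rfl⟩ := List.getLast?_eq_some_iff.mp hPl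
  refine ⟨by simp, ?_, ?_, ?_⟩
  · simpa [List.getLast?_append] using hl
  · cases Q <;> simpa using hPs
  · have h := List.isChain_split.mpr ⟨hPc, (List.isChain_split.mp hc).2⟩
    rw [List.append_assoc]
    exact h

theorem self_mem_critSet : i ∈ S.critSet t' i := fun _ hL =>
  List.mem_of_getLast? hL.2.1

theorem Informed.of_mem_critSet (hi : S.Informed t' i) (hj : j ∈ S.critSet t' i) :
    S.Informed t' j := by
  obtain ⟨L, hL⟩ := hi
  obtain ⟨A, B, rfl⟩ := List.append_of_mem (hj L hL)
  exact ⟨_, hL.truncate⟩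

theorem critSet_trans (hij : i ∈ S.critSet t' j) (hjk : j ∈ S.critSet t' k) :
    i ∈ S.critSet t' k := by
  intro L hL
  obtain ⟨A, B, rfl⟩ := List.append_of_mem (hjk L hL)
  have := hij _ hL.truncate
  simp only [List.mem_append, List.mem_cons, List.not_mem_nil, or_false] at this ⊢
  tauto

theorem critSet_antisymm (hk : S.Informed t' k) (hjk : j ∈ S.critSet t' k)
    (hkj : k ∈ S.critSet t' j) : j = k := by
  obtain ⟨L, hL⟩ := hk
  obtain ⟨A, x, B, rfl, hx, hA⟩ := List.exists_first_of_exists_mem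
    (p := fun x => x = j ∨ x = k) ⟨j, hjk L hL, Or.inl rfl⟩
  have hp := hL.truncate
  obtain rfl | rfl := hx
  · have := hkj _ hp
    grind
  · have := hjk _ hp
    grind

theorem critSet_total (hi : S.Informed t' i) (hj : j ∈ S.critSet t' i)
    (hk : k ∈ S.critSet t' i) : j ∈ S.critSet t' k ∨ k ∈ S.critSet t' j := by
  by_contra! hn
  obtain ⟨hjk, hkj⟩ := hn
  simp only [critSet, Set.mem_ofPred_eq, not_forall] at hjk hkj
  obtain ⟨Q, hQ, hjQ⟩ := hjk
  obtain ⟨P, hP, hkP⟩ := hkj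
  obtain ⟨L, hL⟩ := hi
  obtain ⟨A, x, B, rfl, hx, hB⟩ := List.exists_last_of_exists_mem
    (p := fun x => x = j ∨ x = k) ⟨j, hj L hL, Or.inl rfl⟩
  obtain rfl | rfl := hx
  · have := hk _ (hL.splice hP)
    grind
  · have := hj _ (hL.splice hQ)
    grind

theorem Informed.finite_critSet (hi : S.Informed t' i) : (S.critSet t' i).Finite := by
  obtain ⟨L, hL⟩ := hi
  exact L.finite_toSet.subset fun j hj => hj L hL

theorem IsCritSeq.pairwise {L : List V} (h : S.IsCritSeq t' i L) :
    L.Pairwise (fun a b => a ∈ S.critSet t' b) :=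
  have : Trans (fun a b => a ∈ S.critSet t' b) (fun a b => a ∈ S.critSet t' b)
    (fun a b => a ∈ S.critSet t' b) := ⟨critSet_trans⟩
  List.isChain_iff_pairwise.mp h.2.2.2

theorem isCritSeq_of_pairwise (hi : S.Informed t' i) {L : List V} (hnd : L.Nodup)
    (hmem : ∀ j, j ∈ L ↔ j ∈ S.critSet t' i)
    (hpw : L.Pairwise (fun a b => a ∈ S.critSet t' b)) : S.IsCritSeq t' i L := by
  refine ⟨hnd, hmem, ?_, hpw.isChain⟩
  have hiL : i ∈ L := (hmem i).mpr self_mem_critSet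
  obtain rfl | ⟨A, x, rfl⟩ := L.eq_nil_or_concat'
  · simp at hiL
  have hx : x ∈ S.critSet t' i := (hmem x).mp (by simp)
  obtain hA | hix := List.mem_append.mp hiL
  · have hix := (List.pairwise_append.mp hpw).2.2 i hA x (by simp)
    simp [critSet_antisymm hi hx hix]
  · simpa using (List.mem_singleton.mp hix).symm

theorem IsCritSeq.unique (hi : S.Informed t' i) {L M : List V} (hL : S.IsCritSeq t' i L)
    (hM : S.IsCritSeq t' i M) : L = M := by
  refine List.Perm.eq_of_pairwise (fun a b _ hb hab hba => ?_) hL.pairwise hM.pairwise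
    ((List.perm_ext_iff_of_nodup hL.1 hM.1).mpr fun j => (hL.2.1 j).trans (hM.2.1 j).symm)
  exact critSet_antisymm (hi.of_mem_critSet ((hM.2.1 b).mp hb)) hab hba

theorem Informed.exists_isCritSeq (hi : S.Informed t' i) : ∃ L, S.IsCritSeq t' i L := by
  classical
  have : Fintype (S.critSet t' i) := hi.finite_critSet.fintype
  let r : S.critSet t' i → S.critSet t' i → Prop := fun a b => (a : V) ∈ S.critSet t' b
  have : Std.Total r := ⟨fun a b => critSet_total hi a.2 b.2⟩
  have : IsTrans _ r := ⟨fun _ _ _ => critSet_trans⟩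
  have hperm := List.perm_insertionSort r Finset.univ.toList
  refine ⟨(Finset.univ.toList.insertionSort r).map Subtype.val,
    isCritSeq_of_pairwise hi ?_ ?_ ?_⟩
  · exact (hperm.nodup_iff.mpr (Finset.nodup_toList _)).map Subtype.val_injective
  · simp
  · exact List.pairwise_map.mpr (List.pairwise_insertionSort r _)

end DiffusionSetting

/-- The critical diffusion nodes of any node with non-nil
reported type are totally ordered by the critical-node relation: for any
`j, k ∈ C_i(t')`, either `j ∈ C_k(t')` or `k ∈ C_j(t')`. Consequently there is
a unique fully ordered sequence `C*_i(t')` of all nodes of `C_i(t')`, ending in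
`i`, in which each node is a critical diffusion node of its successor. -/
theorem critical_nodes_totally_ordered
    {V : Type*} (S : DiffusionSetting V)
    (t' : Profile V) (i : V) (hi : S.Informed t' i) :
    (∀ j ∈ S.critSet t' i, ∀ k ∈ S.critSet t' i,
        j ∈ S.critSet t' k ∨ k ∈ S.critSet t' j) ∧
    ∃! L : List V, S.IsCritSeq t' i L := by
  obtain ⟨L, hL⟩ := hi.exists_isCritSeq
  exact ⟨fun _ hj _ hk => DiffusionSetting.critSet_total hi hj hk,
    L, hL, fun _ hM => DiffusionSetting.IsCritSeq.unique hi hM hL⟩
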